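/- arXiv:1910.14402 — 2 statements merged into one kernel-verified Lean document; each statement's English description precedes it below -/
import Mathlib

section
/- Let G be a non-complete simple graph on n vertices with no isolated vertices (every vertex has degree at least 1). Then the largest eigenvalue λ_n of the normalized graph Laplacian of G satisfies λ_n ≥ (n+1)/(n-1). -/
open Finset

/-- The normalized graph Laplacian `Lf(x) = f(x) - (1/d(x)) ∑_{y ~ x} f(y)`. -/
noncomputable def normLap {V : Type*} [Fintype V] [DecidableEq V] (G : SimpleGraph V)
    [DecidableRel G.Adj] (f : V → ℝ) : V → ℝ :=
  fun x => f x - (∑ y ∈ G.neighborFinset x, f y) / (G.degree x : ℝ)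

/-- `μ` is an eigenvalue of the normalized Laplacian of `G`. -/
def IsNormLapEigenvalue {V : Type*} [Fintype V] [DecidableEq V] (G : SimpleGraph V)
    [DecidableRel G.Adj] (μ : ℝ) : Prop :=
  ∃ f : V → ℝ, f ≠ 0 ∧ normLap G f = μ • f

/-- `μ` is the largest eigenvalue of the normalized Laplacian of `G`. -/
def IsMaxNormLapEigenvalue {V : Type*} [Fintype V] [DecidableEq V] (G : SimpleGraph V)
    [DecidableRel G.Adj] (μ : ℝ) : Prop :=
  IsNormLapEigenvalue G μ ∧ ∀ ν, IsNormLapEigenvalue G ν → ν ≤ μ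

/-- The largest eigenvalue of the normalized Laplacian dominates the Rayleigh quotient. -/
theorem IsMaxNormLapEigenvalue.rayleigh_nonneg {V : Type*} [Fintype V] [DecidableEq V]
    {G : SimpleGraph V} [DecidableRel G.Adj] (hdeg : ∀ v : V, 1 ≤ G.degree v)
    {lam : ℝ} (hlam : IsMaxNormLapEigenvalue G lam) (h : V → ℝ) :
    0 ≤ ∑ x, (h x * ∑ y ∈ G.neighborFinset x, h y + (lam - 1) * (G.degree x * h x ^ 2)) := by
  set s : V → ℝ := fun x => √(G.degree x : ℝ)
  have hpos : ∀ x, 0 < s x := fun x => Real.sqrt_pos.2 (by exact_mod_cast hdeg x)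
  have hsq : ∀ x, s x * s x = G.degree x := fun x => Real.mul_self_sqrt (by positivity)
  let M : Matrix V V ℝ := fun x y =>
    (if G.Adj x y then 1 / (s x * s y) else 0) + if x = y then lam - 1 else 0
  have hmul : ∀ (w : V → ℝ) (x : V), M.mulVec w x =
      (∑ y ∈ G.neighborFinset x, w y / s y) / s x + (lam - 1) * w x := by
    intro w x
    simp only [M, Matrix.mulVec, dotProduct, add_mul, sum_add_distrib, ite_mul, zero_mul,
      sum_ite_eq, mem_univ, if_true]
    rw [← sum_filter, ← G.neighborFinset_eq_filter, sum_div]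
    congr 1
    refine sum_congr rfl fun y _ => ?_
    have := (hpos x).ne'
    have := (hpos y).ne'
    field_simp
  have hM : M.IsHermitian := Matrix.IsHermitian.ext fun x y => by
    simp only [M, star_trivial, G.adj_comm y x, eq_comm (a := y), mul_comm (s y)]
  have hpsd : M.PosSemidef := by
    rw [hM.posSemidef_iff_eigenvalues_nonneg]
    intro i
    have hv := hM.mulVec_eigenvectorBasis i
    have hne : (hM.eigenvectorBasis i).ofLp ≠ 0 := fun h0 =>
      hM.eigenvectorBasis.orthonormal.ne_zero i (by ext x; exact congrFun h0 x)
    generalize (hM.eigenvectorBasis i).ofLp = v at hv hne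
    have key : lam - hM.eigenvalues i ≤ lam := by
      refine hlam.2 _ ⟨fun x => v x / s x, fun h0 => hne ?_, ?_⟩
      · ext x
        simpa [(hpos x).ne'] using congrFun h0 x
      · ext x
        have hx := congrFun hv x
        rw [hmul] at hx
        simp only [Pi.smul_apply, smul_eq_mul] at hx
        simp only [normLap, Pi.smul_apply, smul_eq_mul, ← hsq x]
        have := (hpos x).ne'
        field_simp at hx ⊢
        linarith
    simpa using key
  have hquad := hpsd.dotProduct_mulVec_nonneg (fun x => s x * h x)
  simp only [star_trivial] at hquad
  refine hquad.trans_eq (sum_congr rfl fun x _ => ?_)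
  have hsum : ∑ y ∈ G.neighborFinset x, s y * h y / s y = ∑ y ∈ G.neighborFinset x, h y :=
    sum_congr rfl fun y _ => mul_div_cancel_left₀ _ (hpos y).ne'
  rw [hmul, hsum, ← hsq x]
  have := (hpos x).ne'
  field_simp

theorem IsMaxNormLapEigenvalue.one_le {V : Type*} [Fintype V] [DecidableEq V]
    {G : SimpleGraph V} [DecidableRel G.Adj] (hdeg : ∀ v : V, 1 ≤ G.degree v)
    {lam : ℝ} (hlam : IsMaxNormLapEigenvalue G lam) (u : V) : 1 ≤ lam := by
  have h := hlam.rayleigh_nonneg hdeg (Pi.single u 1)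
  rw [sum_eq_single_of_mem u (mem_univ u) (fun x _ hx => by simp [hx])] at h
  have hsum : ∑ y ∈ G.neighborFinset u, (Pi.single u 1 : V → ℝ) y = 0 :=
    sum_eq_zero fun y hy => by
      rw [G.mem_neighborFinset] at hy
      simp [hy.ne']
  rw [hsum] at h
  have hd : (1 : ℝ) ≤ G.degree u := by exact_mod_cast hdeg u
  simp only [Pi.single_eq_same] at h
  nlinarith

/-- Adjacent vertices force `lam - 1` to be at least the inverse of their mean degree. -/
theorem IsMaxNormLapEigenvalue.two_le_of_adj {V : Type*} [Fintype V] [DecidableEq V]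
    {G : SimpleGraph V} [DecidableRel G.Adj] (hdeg : ∀ v : V, 1 ≤ G.degree v)
    {lam : ℝ} (hlam : IsMaxNormLapEigenvalue G lam) {u v : V} (huv : G.Adj u v) :
    2 ≤ (lam - 1) * (G.degree u + G.degree v) := by
  have h := hlam.rayleigh_nonneg hdeg
    (fun x => (if x = u then 1 else 0) - if x = v then 1 else 0)
  rw [← sum_subset (subset_univ {u, v}), sum_pair huv.ne] at h
  · simp [huv, huv.symm, huv.ne, huv.ne', sum_sub_distrib] at h
    linarith
  · intro x _ hx
    simp only [mem_insert, mem_singleton, not_or] at hx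
    simp [hx.1, hx.2]

/-- Two non-adjacent vertices with a common neighbor force `lam ≥ 1 + 2 / (n - 1)`. -/
theorem IsMaxNormLapEigenvalue.two_le_of_common_neighbor {V : Type*} [Fintype V] [DecidableEq V]
    {G : SimpleGraph V} [DecidableRel G.Adj] (hdeg : ∀ v : V, 1 ≤ G.degree v)
    {lam : ℝ} (hlam : IsMaxNormLapEigenvalue G lam) {u v w : V} (huv : u ≠ v)
    (hadj : ¬ G.Adj u v) (hu : G.Adj u w) (hv : G.Adj v w) :
    2 ≤ (lam - 1) * ((Fintype.card V : ℝ) - 1) := by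
  set C := G.neighborFinset u ∩ G.neighborFinset v with hC
  have memC : ∀ x, x ∈ C ↔ G.Adj u x ∧ G.Adj v x := by simp [hC]
  have huC : u ∉ C := by simp [memC]
  have hvC : v ∉ C := by simp [memC]
  have hc1 : 1 ≤ #C := card_pos.2 ⟨w, by simp [memC, hu, hv]⟩
  have hcn : #C + 2 ≤ Fintype.card V := by
    have : #(insert u (insert v C)) = #C + 2 := by
      rw [card_insert_of_notMem (by simp [huv, huC]), card_insert_of_notMem hvC]
    exact this ▸ card_le_univ _
  have hdsum : G.degree u + G.degree v + 2 ≤ Fintype.card V + #C := by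
    have hunion : #(insert u (insert v (G.neighborFinset u ∪ G.neighborFinset v))) =
        #(G.neighborFinset u ∪ G.neighborFinset v) + 2 := by
      rw [card_insert_of_notMem (by simp [huv, G.adj_comm v u, hadj]),
        card_insert_of_notMem (by simp [hadj])]
    have hle := card_le_univ (insert u (insert v (G.neighborFinset u ∪ G.neighborFinset v)))
    have hadd := card_union_add_card_inter (G.neighborFinset u) (G.neighborFinset v)
    rw [← hC, G.card_neighborFinset_eq_degree, G.card_neighborFinset_eq_degree] at hadd
    omega
  have hτ : 0 ≤ lam - 1 := sub_nonneg.2 (hlam.one_le hdeg u)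
  set c : ℝ := (#C : ℝ) with hc
  set N : ℝ := (Fintype.card V : ℝ) - 1 with hN
  set τ := lam - 1 with hτdef
  set f : V → ℝ := fun x =>
    (c + 1) * ((if x = u then 1 else 0) + if x = v then 1 else 0) - 2 * if x ∈ C then 1 else 0
    with hf
  have hsum : ∀ x, ∑ y ∈ G.neighborFinset x, f y =
      (c + 1) * ((if G.Adj x u then 1 else 0) + if G.Adj x v then 1 else 0) -
        2 * (#(G.neighborFinset x ∩ C) : ℝ) := by
    intro x
    simp only [hf, sum_sub_distrib, ← mul_sum, sum_add_distrib, sum_ite_eq', sum_boole,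
      G.mem_neighborFinset, filter_mem_eq_inter]
  have h := hlam.rayleigh_nonneg hdeg f
  rw [← sum_subset (subset_univ (insert u (insert v C))),
    sum_insert (by simp [huv, huC]), sum_insert hvC] at h
  swap
  · intro x _ hx
    simp only [mem_insert, not_or] at hx
    simp [hf, hx.1, hx.2.1, hx.2.2]
  have hfu : f u = c + 1 := by simp [hf, huv, huC]
  have hfv : f v = c + 1 := by simp [hf, huv.symm, hvC]
  have hNu : G.neighborFinset u ∩ C = C := inter_eq_right.2 inter_subset_left
  have hNv : G.neighborFinset v ∩ C = C := inter_eq_right.2 inter_subset_right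
  have hCsum : ∑ x ∈ C, (f x * ∑ y ∈ G.neighborFinset x, f y + τ * (G.degree x * f x ^ 2)) ≤
      ∑ _x ∈ C, (-8 + τ * (4 * N)) := by
    refine sum_le_sum fun x hx => ?_
    have hxu : x ≠ u := fun e => huC (e ▸ hx)
    have hxv : x ≠ v := fun e => hvC (e ▸ hx)
    obtain ⟨h1, h2⟩ := (memC x).1 hx
    have hlt : #(G.neighborFinset x ∩ C) < #C :=
      card_lt_card ⟨inter_subset_right, fun hsub => by simpa using hsub hx⟩
    have hlt' : (#(G.neighborFinset x ∩ C) : ℝ) + 1 ≤ c := by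
      rw [hc]
      exact_mod_cast hlt
    have hdx : (G.degree x : ℝ) ≤ N := by
      have : (G.degree x : ℝ) + 1 ≤ Fintype.card V := by exact_mod_cast G.degree_lt_card_verts x
      linarith
    have hfx : f x = -2 := by simp [hf, hxu, hxv, hx]
    rw [hsum, hfx, if_pos h1.symm, if_pos h2.symm]
    nlinarith [mul_le_mul_of_nonneg_left hdx hτ]
  rw [sum_const, nsmul_eq_mul, ← hc] at hCsum
  rw [hsum, hsum, hfu, hfv, hNu, hNv, if_neg hadj, if_neg (fun h => hadj (G.adj_symm h)),
    if_neg G.irrefl, if_neg G.irrefl, ← hc, ← hτdef] at h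
  have hc1' : (1 : ℝ) ≤ c := by rw [hc]; exact_mod_cast hc1
  have hcN : c + 1 ≤ N := by
    have : c + 2 ≤ Fintype.card V := by rw [hc]; exact_mod_cast hcn
    linarith
  have hS : (G.degree u : ℝ) + G.degree v ≤ N - 1 + c := by
    have : (G.degree u : ℝ) + G.degree v + 2 ≤ Fintype.card V + c := by rw [hc]; exact_mod_cast hdsum
    linarith
  have hbound : 4 * c * (c + 3) ≤ τ * ((c + 1) ^ 2 * (N - 1 + c) + 4 * c * N) := by
    have := mul_le_mul_of_nonneg_left hS (mul_nonneg hτ (sq_nonneg (c + 1)))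
    linarith
  have hcmp : (c + 1) ^ 2 * (N - 1 + c) + 4 * c * N ≤ 2 * c * (c + 3) * N := by
    nlinarith [mul_nonneg (mul_nonneg (sub_nonneg.2 hc1') (by linarith : 0 ≤ c + 1))
      (sub_nonneg.2 hcN)]
  have hfin := hbound.trans (mul_le_mul_of_nonneg_left hcmp hτ)
  have : 0 < 2 * c * (c + 3) := by positivity
  nlinarith

/-- A non-complete graph on `n` vertices with no isolated vertices has
largest normalized Laplacian eigenvalue at least `(n+1)/(n-1)`. -/
theorem maxEigenvalue_ge_of_not_complete {V : Type*} [Fintype V] [DecidableEq V]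
    (G : SimpleGraph V) [DecidableRel G.Adj] (n : ℕ) (hn : n = Fintype.card V)
    (hdeg : ∀ v : V, 1 ≤ G.degree v)
    (hnc : ∃ v w : V, v ≠ w ∧ ¬ G.Adj v w)
    (lam : ℝ) (hlam : IsMaxNormLapEigenvalue G lam) :
    lam ≥ ((n : ℝ) + 1) / ((n : ℝ) - 1) := by
  obtain ⟨v, w, hvw, hadj⟩ := hnc
  have hcard : 1 < Fintype.card V := Fintype.one_lt_card_iff.2 ⟨v, w, hvw⟩
  have hN : (0 : ℝ) < n - 1 := by
    rw [hn, sub_pos]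
    exact_mod_cast hcard
  suffices hkey : 2 ≤ (lam - 1) * ((n : ℝ) - 1) by
    rw [ge_iff_le, div_le_iff₀ hN]
    linarith
  by_cases hcommon : ∃ x y z : V, x ≠ y ∧ ¬ G.Adj x y ∧ G.Adj x z ∧ G.Adj y z
  · obtain ⟨x, y, z, hxy, hnadj, hx, hy⟩ := hcommon
    exact hn ▸ hlam.two_le_of_common_neighbor hdeg hxy hnadj hx hy
  push Not at hcommon
  have hτ : 0 ≤ lam - 1 := sub_nonneg.2 (hlam.one_le hdeg v)
  have hsmall : ∃ x, 2 * G.degree x + 1 ≤ n := by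
    have hdisj : Disjoint (G.neighborFinset v) (G.neighborFinset w) := by
      rw [disjoint_left]
      intro z hz hz'
      rw [G.mem_neighborFinset] at hz hz'
      exact hcommon v w z hvw hadj hz hz'
    have hlt : #(G.neighborFinset v ∪ G.neighborFinset w) < Fintype.card V :=
      card_lt_univ_of_notMem (x := v) (by simp [G.adj_comm w v, hadj])
    rw [card_union_of_disjoint hdisj, G.card_neighborFinset_eq_degree,
      G.card_neighborFinset_eq_degree] at hlt
    rcases le_total (G.degree v) (G.degree w) with h | h
    · exact ⟨v, by omega⟩
    · exact ⟨w, by omega⟩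
  obtain ⟨x, hx⟩ := hsmall
  obtain ⟨y, hy⟩ := card_pos.1 ((hdeg x).trans_eq (G.card_neighborFinset_eq_degree x).symm)
  rw [G.mem_neighborFinset] at hy
  have hxy : G.degree y ≤ G.degree x := by
    have hsub : G.neighborFinset y ⊆ insert x ((G.neighborFinset x).erase y) := by
      intro z hz
      rw [G.mem_neighborFinset] at hz
      by_cases hzx : z = x
      · simp [hzx]
      · have : G.Adj x z := by
          by_contra hna
          exact hcommon x z y (Ne.symm hzx) hna hy hz.symm
        simp [this, hz.ne']
    have hle := (card_le_card hsub).trans (card_insert_le _ _)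
    rwa [card_erase_add_one (by simpa using hy), G.card_neighborFinset_eq_degree,
      G.card_neighborFinset_eq_degree] at hle
  refine (hlam.two_le_of_adj hdeg hy).trans (mul_le_mul_of_nonneg_left ?_ hτ)
  have : G.degree x + G.degree y + 1 ≤ n := by omega
  have : (G.degree x : ℝ) + G.degree y + 1 ≤ n := by exact_mod_cast this
  linarith
end

section
/- Let G be a simple graph on n vertices with no isolated vertices. The largest eigenvalue λ_n of the normalized graph Laplacian of G equals (n+1)/(n-1) if and only if the complement graph of G, after removing isolated vertices of the complement, is a single edge or a complete bipartite graph with both parts of size (n-1)/2. -/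
open Finset

/-- The form `∑ₓ f(x) (c d(x) f(x) + ∑_{y ~ x} f(y))`, which is nonnegative exactly when every
eigenvalue of the normalized Laplacian is at most `1 + c`. -/
noncomputable def shiftedForm {V : Type*} [Fintype V] [DecidableEq V] (G : SimpleGraph V)
    [DecidableRel G.Adj] (c : ℝ) (f : V → ℝ) : ℝ :=
  ∑ x, f x * (c * G.degree x * f x + ∑ y ∈ G.neighborFinset x, f y)

section

variable {V : Type*} [Fintype V] [DecidableEq V] {G : SimpleGraph V} [DecidableRel G.Adj]

lemma normLap_eq_smul_iff (hdeg : ∀ v, 1 ≤ G.degree v) (μ : ℝ) (f : V → ℝ) :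
    normLap G f = μ • f ↔
      ∀ x, ∑ y ∈ G.neighborFinset x, f y = (1 - μ) * G.degree x * f x := by
  rw [funext_iff]
  refine forall_congr' fun x => ?_
  have hd : (G.degree x : ℝ) ≠ 0 := by have := hdeg x; positivity
  simp only [normLap, Pi.smul_apply, smul_eq_mul]
  rw [sub_eq_iff_eq_add, ← sub_eq_iff_eq_add', eq_div_iff hd]
  constructor <;> intro h <;> linarith

lemma le_of_shiftedForm_nonneg (hdeg : ∀ v, 1 ≤ G.degree v) {c ν : ℝ}
    (h : ∀ f : V → ℝ, 0 ≤ shiftedForm G c f) (hν : IsNormLapEigenvalue G ν) : ν ≤ 1 + c := by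
  obtain ⟨f, hf, hfν⟩ := hν
  rw [normLap_eq_smul_iff hdeg] at hfν
  have key : shiftedForm G c f = (1 + c - ν) * ∑ x, G.degree x * f x ^ 2 := by
    rw [shiftedForm, mul_sum]
    refine sum_congr rfl fun x _ => ?_
    rw [hfν]; ring
  obtain ⟨x, hx⟩ := Function.ne_iff.1 hf
  have hpos : 0 < ∑ x, G.degree x * f x ^ 2 := by
    refine sum_pos' (fun _ _ => by positivity) ⟨x, mem_univ x, ?_⟩
    have := hdeg x
    have : f x ≠ 0 := hx
    positivity
  have := h f
  rw [key] at this
  linarith [nonneg_of_mul_nonneg_left this hpos]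

omit [DecidableEq V] in
lemma sum_neighborFinset_eq_sum_adjMatrix_mul (f : V → ℝ) (x : V) :
    ∑ y ∈ G.neighborFinset x, f y = ∑ y, G.adjMatrix ℝ x y * f y := by
  simp [SimpleGraph.adjMatrix_apply, SimpleGraph.neighborFinset_eq_filter, sum_filter]

lemma shiftedForm_nonneg (hdeg : ∀ v, 1 ≤ G.degree v) {c : ℝ}
    (h : ∀ ν, IsNormLapEigenvalue G ν → ν ≤ 1 + c) (f : V → ℝ) : 0 ≤ shiftedForm G c f := by
  set s : V → ℝ := fun x => √(G.degree x) with hs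
  have hs0 : ∀ x, s x ≠ 0 := fun x => by
    have := hdeg x
    simp only [hs]; positivity
  have hss : ∀ x, s x * s x = G.degree x := fun x => Real.mul_self_sqrt (by positivity)
  set M : Matrix V V ℝ := Matrix.of fun x y =>
    (if x = y then c else 0) + (s x)⁻¹ * G.adjMatrix ℝ x y * (s y)⁻¹ with hM
  have hMv : ∀ g x, (M.mulVec g) x =
      c * g x + (s x)⁻¹ * ∑ y ∈ G.neighborFinset x, (s y)⁻¹ * g y := fun g x => by
    rw [sum_neighborFinset_eq_sum_adjMatrix_mul, mul_sum]
    simp only [hM, Matrix.mulVec, dotProduct, Matrix.of_apply, add_mul, sum_add_distrib, ite_mul,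
      zero_mul, sum_ite_eq, mem_univ, if_true]
    congr 1
    exact sum_congr rfl fun y _ => by ring
  have hH : M.IsHermitian := by
    ext x y
    simp only [hM, Matrix.conjTranspose_apply, Matrix.of_apply, star_trivial,
      SimpleGraph.adjMatrix_apply, G.adj_comm y x, eq_comm (a := y)]
    ring
  have hpsd : M.PosSemidef := by
    rw [hH.posSemidef_iff_eigenvalues_nonneg]
    intro i
    have hev := hH.mulVec_eigenvectorBasis i
    set g : V → ℝ := ⇑(hH.eigenvectorBasis i) with hg
    have hg0 : g ≠ 0 := fun h0 => hH.eigenvectorBasis.orthonormal.ne_zero i (by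
      ext x; exact congrFun h0 x)
    have hle := h (1 + c - hH.eigenvalues i) ⟨fun x => (s x)⁻¹ * g x, ?_, ?_⟩
    · change 0 ≤ hH.eigenvalues i; linarith
    · intro h0
      refine hg0 (funext fun x => ?_)
      have := congrFun h0 x
      simpa [hs0 x] using this
    · rw [normLap_eq_smul_iff hdeg]
      intro x
      have hx := congrFun hev x
      rw [hMv] at hx
      simp only [Pi.smul_apply, smul_eq_mul] at hx
      rw [← hss x]
      have := hs0 x
      field_simp at hx ⊢
      linarith
  have h0 := hpsd.dotProduct_mulVec_nonneg fun x => s x * f x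
  refine h0.trans_eq (Eq.symm ?_)
  simp only [shiftedForm, dotProduct, hMv]
  refine sum_congr rfl fun x _ => ?_
  have : ∀ y, (s y)⁻¹ * (s y * f y) = f y := fun y => inv_mul_cancel_left₀ (hs0 y) _
  simp only [this, Pi.star_apply, star_trivial]
  rw [← hss x]
  have := hs0 x
  field_simp

lemma sum_neighborFinset_add_compl (f : V → ℝ) (x : V) :
    ∑ y ∈ G.neighborFinset x, f y = ∑ y, f y - f x - ∑ y with Gᶜ.Adj x y, f y := by
  have h : ∀ y, f y = (if G.Adj x y then f y else 0) + (if x = y then f y else 0) +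
      (if Gᶜ.Adj x y then f y else 0) := fun y => by
    simp only [SimpleGraph.compl_adj]
    by_cases hxy : x = y
    · subst hxy; simp
    · by_cases ha : G.Adj x y <;> simp [hxy, ha]
  have hS : ∑ y, f y = ∑ y ∈ G.neighborFinset x, f y + f x + ∑ y with Gᶜ.Adj x y, f y := by
    conv_lhs => rw [sum_congr rfl fun y _ => h y]
    simp [sum_add_distrib, sum_filter, SimpleGraph.neighborFinset_eq_filter]
  linarith

lemma isMax_of_compl_bipartite (hdeg : ∀ v, 1 ≤ G.degree v) {P Q : Finset V} {p : ℝ}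
    (hPQ : Disjoint P Q) (hP : (#P : ℝ) = p) (hQ : (#Q : ℝ) = p)
    (hn : 2 < Fintype.card V) (hp : p = 1 ∨ 2 * p = Fintype.card V - 1)
    (hadj : ∀ x y, Gᶜ.Adj x y ↔ ((x ∈ P ∧ y ∈ Q) ∨ (x ∈ Q ∧ y ∈ P))) :
    IsMaxNormLapEigenvalue G (((Fintype.card V : ℝ) + 1) / ((Fintype.card V : ℝ) - 1)) := by
  set N : ℝ := (Fintype.card V : ℝ) with hN
  have hN2 : (3 : ℝ) ≤ N := by rw [hN]; exact_mod_cast hn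
  have hN1 : N - 1 ≠ 0 := by linarith
  have hp1 : 1 ≤ p := by rcases hp with h | h <;> linarith
  have hpN : 2 * p ≤ N - 1 := by rcases hp with h | h <;> linarith
  have hnot : ∀ x, x ∈ P → x ∉ Q := fun _ h => Finset.disjoint_left.1 hPQ h
  have hsum : ∀ (f : V → ℝ) x, ∑ y ∈ G.neighborFinset x, f y = ∑ y, f y - f x -
      (if x ∈ P then ∑ y ∈ Q, f y else if x ∈ Q then ∑ y ∈ P, f y else 0) := fun f x => by
    rw [sum_neighborFinset_add_compl]
    simp only [hadj]
    congr 1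
    by_cases h1 : x ∈ P
    · simp [h1, hnot x h1]
    · by_cases h2 : x ∈ Q <;> simp [h1, h2]
  have hdegree : ∀ x, (G.degree x : ℝ) = N - 1 - if x ∈ P ∪ Q then p else 0 := fun x => by
    have := hsum (fun _ => 1) x
    simp only [sum_const, nsmul_eq_mul, mul_one, SimpleGraph.card_neighborFinset_eq_degree,
      card_univ, hP, hQ] at this
    rw [this]
    by_cases h1 : x ∈ P
    · simp [h1, hN]
    · by_cases h2 : x ∈ Q <;> simp [h1, h2, hN]
  have hsplit : ∀ f : V → ℝ, ∑ y, f y = ∑ y ∈ P, f y + ∑ y ∈ Q, f y + ∑ y ∈ (P ∪ Q)ᶜ, f y :=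
    fun f => by rw [← sum_union hPQ, sum_add_sum_compl]
  have hcard : (#((P ∪ Q)ᶜ) : ℝ) = N - 2 * p := by
    have := hsplit fun _ => 1
    simp only [sum_const, nsmul_eq_mul, mul_one, hP, hQ, card_univ] at this
    linarith
  have hμ : (N + 1) / (N - 1) = 1 + 2 / (N - 1) := by field_simp; ring
  obtain ⟨τ, hτ⟩ : ∃ τ, τ * (N - 2 * p + 1) = 2 * p :=
    ⟨2 * p / (N - 2 * p + 1), div_mul_cancel₀ _ (by linarith)⟩
  have hc : 2 / (N - 1) * (N - 1) = 2 := div_mul_cancel₀ _ hN1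
  rw [hμ]
  refine ⟨⟨fun x => if x ∈ P ∪ Q then 1 else -τ, ?_, ?_⟩,
    fun ν hν => le_of_shiftedForm_nonneg hdeg (fun f => ?_) hν⟩
  · intro h0
    obtain ⟨x, hx⟩ : P.Nonempty := by
      rw [← card_pos, ← Nat.cast_pos (α := ℝ), hP]; linarith
    simpa [hx] using congrFun h0 x
  · rw [normLap_eq_smul_iff hdeg]
    intro x
    have sP : ∑ y ∈ P, (if y ∈ P ∪ Q then 1 else -τ) = p := by
      rw [sum_congr rfl fun y hy => if_pos (mem_union_left Q hy)]; simp [hP]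
    have sQ : ∑ y ∈ Q, (if y ∈ P ∪ Q then 1 else -τ) = p := by
      rw [sum_congr rfl fun y hy => if_pos (mem_union_right P hy)]; simp [hQ]
    have sR : ∑ y ∈ (P ∪ Q)ᶜ, (if y ∈ P ∪ Q then 1 else -τ) =
        -(N - 2 * p) * τ := by
      rw [sum_congr rfl fun y hy => if_neg (mem_compl.1 hy), sum_const, nsmul_eq_mul, hcard]; ring
    rw [hsum, hsplit, sP, sQ, sR, hdegree]
    by_cases h1 : x ∈ P ∪ Q
    · have h2 : (if x ∈ P then p else if x ∈ Q then p else 0) = p := by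
        rcases mem_union.1 h1 with h | h <;> simp [h]
      simp only [h1, if_true, h2]
      rcases hp with h | h
      · have : τ = 2 / (N - 1) := by
          rw [eq_div_iff hN1]; rw [h] at hτ; linarith
        rw [h, this]
        ring
      · have h3 : N - 2 * p = 1 := by linarith
        rw [h3] at hτ ⊢
        rw [← h] at hc ⊢
        linarith
    · have h2 : (if x ∈ P then p else if x ∈ Q then p else 0) = 0 := by
        rw [mem_union, not_or] at h1; simp [h1]
      simp only [h1, if_false, h2]
      linear_combination -τ * hc - hτ
  · set A := ∑ y ∈ P, f y
    set B := ∑ y ∈ Q, f y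
    set R := ∑ y ∈ (P ∪ Q)ᶜ, f y
    set A2 := ∑ y ∈ P, f y ^ 2
    set B2 := ∑ y ∈ Q, f y ^ 2
    set R2 := ∑ y ∈ (P ∪ Q)ᶜ, f y ^ 2
    have hform : shiftedForm G (2 / (N - 1)) f =
        (1 - 2 / (N - 1) * p) * (A2 + B2) + R2 + (A + B + R) ^ 2 - 2 * A * B := by
      rw [shiftedForm, hsplit]
      have e1 : ∑ x ∈ P, f x * (2 / (N - 1) * G.degree x * f x + ∑ y ∈ G.neighborFinset x, f y) =
          (1 - 2 / (N - 1) * p) * A2 + (A + B + R - B) * A := by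
        rw [mul_sum, mul_sum, ← sum_add_distrib]
        refine sum_congr rfl fun x hx => ?_
        rw [hsum, hsplit, hdegree, if_pos (mem_union_left Q hx), if_pos hx]
        field_simp
        ring
      have e2 : ∑ x ∈ Q, f x * (2 / (N - 1) * G.degree x * f x + ∑ y ∈ G.neighborFinset x, f y) =
          (1 - 2 / (N - 1) * p) * B2 + (A + B + R - A) * B := by
        rw [mul_sum, mul_sum, ← sum_add_distrib]
        refine sum_congr rfl fun x hx => ?_
        rw [hsum, hsplit, hdegree, if_pos (mem_union_right P hx),
          if_neg fun h => hnot x h hx, if_pos hx]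
        field_simp
        ring
      have e3 : ∑ x ∈ (P ∪ Q)ᶜ,
          f x * (2 / (N - 1) * G.degree x * f x + ∑ y ∈ G.neighborFinset x, f y) =
          R2 + (A + B + R) * R := by
        rw [mul_sum, ← sum_add_distrib]
        refine sum_congr rfl fun x hx => ?_
        have hx' := mem_compl.1 hx
        rw [hsum, hsplit, hdegree, if_neg hx']
        rw [mem_union, not_or] at hx'
        rw [if_neg hx'.1, if_neg hx'.2]
        field_simp
        ring
      rw [e1, e2, e3]
      ring
    have hA : A ^ 2 ≤ p * A2 := hP ▸ sq_sum_le_card_mul_sum_sq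
    have hB : B ^ 2 ≤ p * B2 := hQ ▸ sq_sum_le_card_mul_sum_sq
    have hR : R ^ 2 ≤ (N - 2 * p) * R2 := hcard ▸ sq_sum_le_card_mul_sum_sq
    have hR' : (A + B) ^ 2 ≤ (N - 2 * p + 1) * (R2 + (A + B + R) ^ 2) := by
      nlinarith [sq_nonneg ((N - 2 * p) * (A + B + R) + R)]
    rw [hform]
    rcases hp with h | h
    · subst h
      have h1 : (1 - 2 / (N - 1) * 1) * (A ^ 2 + B ^ 2) ≤
          (1 - 2 / (N - 1) * 1) * (A2 + B2) := by
        refine mul_le_mul_of_nonneg_left (by linarith) ?_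
        rw [mul_one, sub_nonneg, div_le_one (by linarith)]; linarith
      have h2 : (A + B) ^ 2 / (N - 1) ≤ R2 + (A + B + R) ^ 2 := by
        rw [div_le_iff₀ (by linarith)]; linarith
      have h3 : (1 - 2 / (N - 1) * 1) * (A ^ 2 + B ^ 2) + (A + B) ^ 2 / (N - 1) - 2 * A * B =
          (N - 2) / (N - 1) * (A - B) ^ 2 := by field_simp; ring
      have h4 : 0 ≤ (N - 2) / (N - 1) * (A - B) ^ 2 := by
        have : 0 ≤ N - 2 := by linarith
        have : 0 ≤ N - 1 := by linarith
        positivity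
      linarith
    · have h1 : 1 - 2 / (N - 1) * p = 0 := by field_simp; linarith
      rw [h1]
      nlinarith [sq_nonneg (A - B)]

lemma shiftedForm_single_sub_single {c : ℝ} {u v : V} (huv : G.Adj u v) :
    shiftedForm G c (Pi.single u 1 - Pi.single v 1) = c * (G.degree u + G.degree v) - 2 := by
  have hne := huv.ne
  have h : ∀ x, ∑ y ∈ G.neighborFinset x, (Pi.single u (1 : ℝ) - Pi.single v 1 : V → ℝ) y =
      (if G.Adj x u then 1 else 0) - if G.Adj x v then 1 else 0 := fun x => by
    simp [Pi.single_apply, sum_sub_distrib]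
  simp only [shiftedForm, h]
  rw [← sum_subset (subset_univ {u, v}), sum_pair hne]
  · simp [hne, hne.symm, huv, huv.symm]; ring
  · intro x _ hx
    simp only [mem_insert, mem_singleton, not_or] at hx
    simp [hx.1, hx.2]

/-- Test function for a nonadjacent pair: constants `a` at `v`, `b` at `w` and `-t` on their
common neighbours. -/
lemma shiftedForm_common_neighbors_le {v w : V} (hne : v ≠ w) (hvw : ¬ G.Adj v w)
    (c a b t : ℝ) :
    shiftedForm G c (fun x => if x = v then a else if x = w then b else
      if x ∈ G.neighborFinset v ∩ G.neighborFinset w then -t else 0) ≤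
    c * (a ^ 2 * G.degree v + b ^ 2 * G.degree w)
      - 2 * t * #(G.neighborFinset v ∩ G.neighborFinset w) * (a + b)
      + t ^ 2 * ∑ x ∈ G.neighborFinset v ∩ G.neighborFinset w,
        (c * G.degree x + (#(G.neighborFinset v ∩ G.neighborFinset w) - 1)) := by
  set K := G.neighborFinset v ∩ G.neighborFinset w with hK
  have hmem : ∀ x, x ∈ K ↔ G.Adj v x ∧ G.Adj w x := fun x => by simp [hK]
  have hvK : v ∉ K := by simp [hmem]
  have hwK : w ∉ K := by simp [hmem]
  set f : V → ℝ := fun x => if x = v then a else if x = w then b else if x ∈ K then -t else 0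
    with hf
  have hfv : f v = a := by simp [hf]
  have hfw : f w = b := by simp [hf, hne.symm]
  have hfK : ∀ x ∈ K, f x = -t := fun x hx => by
    have h1 : x ≠ v := fun h => hvK (h ▸ hx)
    have h2 : x ≠ w := fun h => hwK (h ▸ hx)
    simp [hf, h1, h2, hx]
  have hwv : ¬ G.Adj w v := fun h => hvw h.symm
  have hsplit : ∀ g : V → ℝ, (∀ x, f x = 0 → g x = 0) →
      ∑ x, g x = g v + g w + ∑ x ∈ K, g x := fun g hg => by
    rw [← sum_subset (subset_univ (insert v (insert w K))), sum_insert, sum_insert hwK, add_assoc]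
    · simp [hne, hvK]
    · intro x _ hx
      simp only [mem_insert, not_or] at hx
      exact hg x (by simp [hf, hx])
  have hnb : ∀ x, ∑ y ∈ G.neighborFinset x, f y = (if G.Adj x v then a else 0) +
      (if G.Adj x w then b else 0) - t * #(K ∩ G.neighborFinset x) := fun x => by
    rw [SimpleGraph.neighborFinset_eq_filter, sum_filter, hsplit, hfv, hfw, ← sum_filter]
    · rw [sum_congr rfl fun y hy => hfK y (mem_filter.1 hy).1]
      rw [inter_filter, inter_univ, sum_const, nsmul_eq_mul]
      ring
    · intro y hy; simp [hy]
  have hKv : K ∩ G.neighborFinset v = K := by ext x; simp [hmem]; tauto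
  have hKw : K ∩ G.neighborFinset w = K := by ext x; simp [hmem]
  rw [shiftedForm, hsplit _ fun x hx => by simp [hx], hnb, hnb, hfv, hfw, hKv, hKw]
  have hle : ∑ x ∈ K, f x * (c * G.degree x * f x + ∑ y ∈ G.neighborFinset x, f y) ≤
      ∑ x ∈ K, (t ^ 2 * (c * G.degree x + (#K - 1)) - t * (a + b)) := by
    refine sum_le_sum fun x hx => ?_
    obtain ⟨h1, h2⟩ := (hmem x).1 hx
    rw [hnb, hfK x hx, if_pos h1.symm, if_pos h2.symm]
    have hlt : #(K ∩ G.neighborFinset x) < #K :=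
      card_lt_card ⟨inter_subset_left, fun h => by simpa using h hx⟩
    have hlt' : (#(K ∩ G.neighborFinset x) : ℝ) ≤ #K - 1 := by
      rw [le_sub_iff_add_le]; exact_mod_cast hlt
    nlinarith [mul_le_mul_of_nonneg_left hlt' (sq_nonneg t)]
  rw [sum_sub_distrib, ← mul_sum, sum_const, nsmul_eq_mul] at hle
  simp only [G.irrefl, hvw, hwv, if_false]
  linarith

/-- A nonadjacent pair with a common neighbour, when no eigenvalue exceeds `(n + 1) / (n - 1)`. -/
lemma rigidity_of_not_adj
    (h : ∀ f : V → ℝ, 0 ≤ shiftedForm G (2 / ((Fintype.card V : ℝ) - 1)) f)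
    {v w u : V} (hne : v ≠ w) (hvw : ¬ G.Adj v w) (hvu : G.Adj v u) (hwu : G.Adj w u) :
    (#(G.neighborFinset v ∩ G.neighborFinset w) = 1 ∨
      #(G.neighborFinset v ∩ G.neighborFinset w) + 2 = Fintype.card V) ∧
    G.degree v = G.degree w ∧
    #(G.neighborFinset v ∪ G.neighborFinset w) + 2 = Fintype.card V ∧
    ∀ x ∈ G.neighborFinset v ∩ G.neighborFinset w, G.degree x + 1 = Fintype.card V := by
  have hform := shiftedForm_common_neighbors_le hne hvw (2 / ((Fintype.card V : ℝ) - 1))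
    (G.degree w) (G.degree v)
    (((G.degree v : ℝ) + G.degree w) / (#(G.neighborFinset v ∩ G.neighborFinset w) + 1))
  replace hform := (h _).trans hform
  have hunion : #(G.neighborFinset v ∪ G.neighborFinset w) + 2 ≤ Fintype.card V := by
    have hsub : G.neighborFinset v ∪ G.neighborFinset w ⊆ ({v, w} : Finset V)ᶜ := by
      intro x hx
      simp only [mem_union, SimpleGraph.mem_neighborFinset] at hx
      simp only [mem_compl, mem_insert, mem_singleton, not_or]
      constructor <;> rintro rfl
      · exact hx.elim G.irrefl fun h => hvw h.symm
      · exact hx.elim hvw G.irrefl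
    have h1 := card_le_card hsub
    rw [card_compl, card_pair hne] at h1
    have h2 : #({v, w} : Finset V) ≤ Fintype.card V := card_le_univ _
    rw [card_pair hne] at h2
    omega
  have hui := card_union_add_card_inter (G.neighborFinset v) (G.neighborFinset w)
  rw [SimpleGraph.card_neighborFinset_eq_degree, SimpleGraph.card_neighborFinset_eq_degree] at hui
  have hKpos : 1 ≤ #(G.neighborFinset v ∩ G.neighborFinset w) :=
    card_pos.2 ⟨u, by simp [hvu, hwu]⟩
  have hKle : #(G.neighborFinset v ∩ G.neighborFinset w) ≤
      #(G.neighborFinset v ∪ G.neighborFinset w) :=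
    card_le_card (inter_subset_left.trans subset_union_left)
  set K := G.neighborFinset v ∩ G.neighborFinset w
  have hdle : ∀ x, (G.degree x : ℝ) ≤ Fintype.card V - 1 := fun x => by
    rw [le_sub_iff_add_le]; exact_mod_cast G.degree_lt_card_verts x
  have hE0 : ∀ x ∈ K, (0 : ℝ) ≤ Fintype.card V - 1 - G.degree x := fun x _ => by
    linarith [hdle x]
  have hE : 0 ≤ ∑ x ∈ K, ((Fintype.card V : ℝ) - 1 - G.degree x) := sum_nonneg hE0
  have hsumK : ∑ x ∈ K, (2 / ((Fintype.card V : ℝ) - 1) * G.degree x + ((#K : ℝ) - 1)) =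
      2 / ((Fintype.card V : ℝ) - 1) *
        (#K * ((Fintype.card V : ℝ) - 1) - ∑ x ∈ K, ((Fintype.card V : ℝ) - 1 - G.degree x)) +
      #K * ((#K : ℝ) - 1) := by
    simp only [sum_add_distrib, ← mul_sum, sum_sub_distrib, sum_const, nsmul_eq_mul]
    ring
  rw [hsumK] at hform
  set U := G.neighborFinset v ∪ G.neighborFinset w
  set E := ∑ x ∈ K, ((Fintype.card V : ℝ) - 1 - G.degree x)
  have hk : (1 : ℝ) ≤ #K := by exact_mod_cast hKpos
  have hkU : (#K : ℝ) ≤ #U := by exact_mod_cast hKle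
  have hUn : (#U : ℝ) + 2 ≤ Fintype.card V := by exact_mod_cast hunion
  have hs : (#U : ℝ) + #K = G.degree v + G.degree w := by exact_mod_cast hui
  obtain ⟨e1, e2, e3, e4⟩ : (((#K : ℝ) - 1) * (Fintype.card V - 2 - #K) = 0) ∧
      (G.degree v : ℝ) = G.degree w ∧ (#U : ℝ) + 2 = Fintype.card V ∧ E = 0 := by
    clear_value E
    generalize (#K : ℝ) = k at *
    generalize (#U : ℝ) = m at *
    generalize (G.degree v : ℝ) = a at *
    generalize (G.degree w : ℝ) = b at *
    generalize (Fintype.card V : ℝ) = N at *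
    have hN : 0 < N - 1 := by linarith
    have hab : 0 < a + b := by linarith
    have hk1 : 0 < k + 1 := by linarith
    have key : 2 / (N - 1) * (b ^ 2 * a + a ^ 2 * b) - 2 * ((a + b) / (k + 1)) * k * (b + a) +
        ((a + b) / (k + 1)) ^ 2 * (2 / (N - 1) * (k * (N - 1) - E) + k * (k - 1)) =
        (a + b) / (2 * (N - 1) * (k + 1)) * ((a + b) * ((a + b) * (k + 1) - 2 * (N - 1) * k) -
          (k + 1) * (a - b) ^ 2 - 4 * (a + b) * E / (k + 1)) := by
      field_simp
      ring
    rw [key] at hform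
    replace hform := nonneg_of_mul_nonneg_right hform (by positivity)
    have hfac : (a + b) * (k + 1) - 2 * (N - 1) * k =
        -((k - 1) * (N - 2 - k)) - (N - 2 - m) * (k + 1) := by
      rw [← hs]; ring
    rw [hfac] at hform
    have t1 : 0 ≤ (k - 1) * (N - 2 - k) := mul_nonneg (by linarith) (by linarith)
    have t2 : 0 ≤ (N - 2 - m) * (k + 1) := mul_nonneg (by linarith) hk1.le
    have t3 : 0 ≤ (k + 1) * (a - b) ^ 2 := by positivity
    have t4 : 0 ≤ 4 * (a + b) * E / (k + 1) := by positivity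
    have u1 := mul_nonneg hab.le t1
    have u2 := mul_nonneg hab.le t2
    have v1 : (a + b) * ((k - 1) * (N - 2 - k)) = 0 := by linarith
    have v2 : (a + b) * ((N - 2 - m) * (k + 1)) = 0 := by linarith
    have v3 : (k + 1) * (a - b) ^ 2 = 0 := by linarith
    have v4 : 4 * (a + b) * E / (k + 1) = 0 := by linarith
    have n1 := hab.ne'
    have n2 := hk1.ne'
    refine ⟨(mul_eq_zero.1 v1).resolve_left n1, ?_, ?_, ?_⟩
    · exact sub_eq_zero.1 (pow_eq_zero_iff two_ne_zero |>.1 ((mul_eq_zero.1 v3).resolve_left n2))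
    · have := (mul_eq_zero.1 ((mul_eq_zero.1 v2).resolve_left n1)).resolve_right n2
      linarith
    · have := (div_eq_zero_iff.1 v4).resolve_right n2
      exact (mul_eq_zero.1 this).resolve_left (by positivity)
  refine ⟨?_, by exact_mod_cast e2, by exact_mod_cast e3, fun x hx => ?_⟩
  · rcases mul_eq_zero.1 e1 with h1 | h1
    · left; exact_mod_cast (sub_eq_zero.1 h1)
    · right
      have : (#K : ℝ) + 2 = Fintype.card V := by linarith
      exact_mod_cast this
  · have := (sum_eq_zero_iff_of_nonneg hE0).1 e4 x hx
    have : (G.degree x : ℝ) + 1 = Fintype.card V := by linarith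
    exact_mod_cast this

lemma not_isNormLapEigenvalue_of_forall_adj (hdeg : ∀ v, 1 ≤ G.degree v)
    (hG : ∀ x y, x ≠ y → G.Adj x y) :
    ¬ IsNormLapEigenvalue G (((Fintype.card V : ℝ) + 1) / ((Fintype.card V : ℝ) - 1)) := by
  rintro ⟨f, hf, hfe⟩
  rw [normLap_eq_smul_iff hdeg] at hfe
  obtain ⟨x₀, -⟩ := Function.ne_iff.1 hf
  have hdx : ∀ x, (G.degree x : ℝ) = Fintype.card V - 1 := fun x => by
    have : G.degree x + 1 = Fintype.card V := by
      rw [← SimpleGraph.card_neighborFinset_eq_degree]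
      have : G.neighborFinset x = univ.erase x := by
        ext y; simp only [SimpleGraph.mem_neighborFinset, mem_erase, mem_univ, and_true]
        exact ⟨fun h => h.ne', fun h => hG x y h.symm⟩
      rw [this, card_erase_add_one (mem_univ x), card_univ]
    rw [eq_sub_iff_add_eq]; exact_mod_cast this
  have hN : (1 : ℝ) ≤ Fintype.card V - 1 := by rw [← hdx x₀]; exact_mod_cast hdeg x₀
  have hN' : (Fintype.card V : ℝ) - 1 ≠ 0 := by linarith
  have hfx : ∀ x, f x = - ∑ y, f y := fun x => by
    have h1 := hfe x
    have h2 : ∑ y with Gᶜ.Adj x y, f y = 0 := by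
      rw [filter_false_of_mem, sum_empty]
      intro y _ h
      exact h.2 (hG x y h.1)
    rw [sum_neighborFinset_add_compl, h2, hdx] at h1
    field_simp at h1
    linarith
  have hS : ∑ y, f y = 0 := by
    have : ∑ x, f x = Fintype.card V * - ∑ y, f y := by
      conv_lhs => rw [sum_congr rfl fun x _ => hfx x]
      simp
    have : (Fintype.card V + 1) * ∑ y, f y = 0 := by linarith
    refine (mul_eq_zero.1 this).resolve_left (by linarith)
  exact hf (funext fun x => by rw [hfx, hS]; simp)

/-- If nonadjacent vertices never have a common neighbour, then `G` is complete. -/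
lemma adj_of_adj_trans (hdeg : ∀ v, 1 ≤ G.degree v)
    (h : ∀ f : V → ℝ, 0 ≤ shiftedForm G (2 / ((Fintype.card V : ℝ) - 1)) f)
    (htrans : ∀ x y z, x ≠ y → G.Adj x z → G.Adj y z → G.Adj x y) (v w : V) (hne : v ≠ w) :
    G.Adj v w := by
  by_contra hvw
  have hbig : ∀ x, Fintype.card V ≤ 2 * G.degree x + 1 := fun x => by
    obtain ⟨y, hy⟩ := (G.degree_pos_iff_exists_adj x).1 (hdeg x)
    have h1 := h (Pi.single x 1 - Pi.single y 1)
    rw [shiftedForm_single_sub_single hy] at h1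
    have hle : G.degree y ≤ G.degree x := by
      have hsub : (G.neighborFinset y).erase x ⊆ (G.neighborFinset x).erase y := by
        intro z hz
        simp only [mem_erase, SimpleGraph.mem_neighborFinset] at hz ⊢
        exact ⟨hz.2.ne', htrans x z y hz.1.symm hy hz.2.symm⟩
      have h2 := card_le_card hsub
      rw [card_erase_of_mem (by simpa using hy.symm), card_erase_of_mem (by simpa using hy),
        SimpleGraph.card_neighborFinset_eq_degree, SimpleGraph.card_neighborFinset_eq_degree] at h2
      have := hdeg x
      omega
    have hN : (0 : ℝ) < Fintype.card V - 1 := by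
      have : (1 : ℝ) < Fintype.card V := by
        exact_mod_cast (hdeg x).trans_lt (G.degree_lt_card_verts x)
      linarith
    have hle' : (G.degree y : ℝ) ≤ G.degree x := by exact_mod_cast hle
    rw [div_mul_eq_mul_div, sub_nonneg, le_div_iff₀ hN] at h1
    have : (Fintype.card V : ℝ) ≤ 2 * G.degree x + 1 := by linarith
    exact_mod_cast this
  have hdisj : Disjoint (insert v (G.neighborFinset v)) (insert w (G.neighborFinset w)) := by
    rw [Finset.disjoint_left]
    intro x hx hy
    simp only [mem_insert, SimpleGraph.mem_neighborFinset] at hx hy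
    rcases hx with rfl | hx
    · exact hy.elim hne fun h => hvw h.symm
    · rcases hy with rfl | hy
      · exact hvw hx
      · exact hvw (htrans v w x hne hx hy)
  have hcard := card_le_univ (insert v (G.neighborFinset v) ∪ insert w (G.neighborFinset w))
  rw [card_union_of_disjoint hdisj, card_insert_of_notMem (by simp),
    card_insert_of_notMem (by simp), SimpleGraph.card_neighborFinset_eq_degree,
    SimpleGraph.card_neighborFinset_eq_degree] at hcard
  have := hbig v
  have := hbig w
  omega

lemma adj_of_degree_add_one_eq_card {x y : V} (hx : G.degree x + 1 = Fintype.card V)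
    (hxy : x ≠ y) : G.Adj x y := by
  have h : insert x (G.neighborFinset x) = univ := by
    rw [← card_eq_iff_eq_univ, card_insert_of_notMem (by simp),
      SimpleGraph.card_neighborFinset_eq_degree, hx]
  have := h ▸ mem_univ y
  simpa [hxy.symm] using this

omit [Fintype V] [DecidableRel G.Adj] in
/-- Nonadjacent pairs splitting the remaining vertices evenly force the complement to be complete
bipartite. -/
lemma compl_adj_iff_of_split {u v w : V} (hne : v ≠ w) (hvw : ¬ G.Adj v w)
    (hu : ∀ x, u ≠ x → G.Adj u x)
    (hsplit : ∀ x y z, x ≠ y → ¬ G.Adj x y → z ≠ x → z ≠ y → z ≠ u →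
      (G.Adj z x ↔ ¬ G.Adj z y)) (x y : V) :
    Gᶜ.Adj x y ↔ (Gᶜ.Adj w x ∧ Gᶜ.Adj v y) ∨ (Gᶜ.Adj v x ∧ Gᶜ.Adj w y) := by
  simp only [SimpleGraph.compl_adj]
  have hsymm : ∀ a b, G.Adj a b → G.Adj b a := fun _ _ h => h.symm
  have hvu : v ≠ u := fun h => hvw (h ▸ hu w (h ▸ hne))
  have hwu : w ≠ u := fun h => hvw (hsymm _ _ (h ▸ hu v (h ▸ hne.symm)))
  by_cases hx : x = u
  · grind
  by_cases hy : y = u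
  · grind
  by_cases hxv : x = v <;> by_cases hxw : x = w <;> by_cases hyv : y = v <;>
    by_cases hyw : y = w <;> by_cases hxy : x = y <;> grind

end

/-- For a graph on `n` vertices with no isolated vertices, the largest
normalized Laplacian eigenvalue equals `(n+1)/(n-1)` iff the complement, after removing
isolated vertices, is a single edge or a complete bipartite graph with both parts of
size `(n-1)/2`. -/
theorem maxEigenvalue_eq_iff {V : Type*} [Fintype V] [DecidableEq V]
    (G : SimpleGraph V) [DecidableRel G.Adj] (n : ℕ) (hn : n = Fintype.card V)
    (hdeg : ∀ v : V, 1 ≤ G.degree v) :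
    IsMaxNormLapEigenvalue G (((n : ℝ) + 1) / ((n : ℝ) - 1)) ↔
      ((∃ v w : V, v ≠ w ∧
          ∀ x y : V, Gᶜ.Adj x y ↔ ((x = v ∧ y = w) ∨ (x = w ∧ y = v))) ∨
       (∃ P Q : Finset V, Disjoint P Q ∧
          2 * (P.card : ℝ) = (n : ℝ) - 1 ∧ 2 * (Q.card : ℝ) = (n : ℝ) - 1 ∧
          ∀ x y : V, Gᶜ.Adj x y ↔ ((x ∈ P ∧ y ∈ Q) ∨ (x ∈ Q ∧ y ∈ P)))) := by
  subst hn
  constructor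
  · rintro ⟨hev, hmax⟩
    have hN1 : (Fintype.card V : ℝ) - 1 ≠ 0 := by
      obtain ⟨f, hf, -⟩ := hev
      obtain ⟨x, -⟩ := Function.ne_iff.1 hf
      have : (1 : ℝ) < Fintype.card V := by
        exact_mod_cast (hdeg x).trans_lt (G.degree_lt_card_verts x)
      linarith
    have hform := shiftedForm_nonneg (G := G) (c := 2 / ((Fintype.card V : ℝ) - 1)) hdeg
      fun ν hν => (hmax ν hν).trans_eq (by field_simp; ring)
    by_cases htrans : ∀ x y z, x ≠ y → G.Adj x z → G.Adj y z → G.Adj x y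
    · exact absurd hev
        (not_isNormLapEigenvalue_of_forall_adj hdeg (adj_of_adj_trans hdeg hform htrans))
    push Not at htrans
    obtain ⟨v, w, u, hne, hvu, hwu, hvw⟩ := htrans
    have hu : ∀ x, u ≠ x → G.Adj u x := fun x => adj_of_degree_add_one_eq_card
      ((rigidity_of_not_adj hform hne hvw hvu hwu).2.2.2 u (by simp [hvu, hwu]))
    have hnu : ∀ x y, x ≠ y → ¬ G.Adj x y → G.Adj x u ∧ G.Adj y u := fun x y hxy h =>
      ⟨(hu x fun e => h (e ▸ hu y (e ▸ hxy))).symm,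
        (hu y fun e => h (e ▸ hu x (e ▸ hxy.symm)).symm).symm⟩
    have hrig := fun x y (hxy : x ≠ y) (h : ¬ G.Adj x y) =>
      rigidity_of_not_adj hform hxy h (hnu x y hxy h).1 (hnu x y hxy h).2
    have hcover : ∀ x y, x ≠ y → ¬ G.Adj x y → ∀ z, z ≠ x → z ≠ y → G.Adj x z ∨ G.Adj y z := by
      intro x y hxy h z hzx hzy
      by_contra! hz
      have hsub : G.neighborFinset x ∪ G.neighborFinset y ⊆ ({x, y, z} : Finset V)ᶜ := by
        intro a ha
        simp only [mem_union, SimpleGraph.mem_neighborFinset] at ha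
        simp only [mem_compl, mem_insert, mem_singleton, not_or]
        refine ⟨?_, ?_, ?_⟩ <;> rintro rfl
        · exact ha.elim G.irrefl fun h' => h h'.symm
        · exact ha.elim h G.irrefl
        · exact ha.elim hz.1 hz.2
      have h1 := card_le_card hsub
      have h3 : #({x, y, z} : Finset V) = 3 := card_eq_three.2 ⟨x, y, z, hxy, hzx.symm, hzy.symm, rfl⟩
      have h2 := card_le_univ ({x, y, z} : Finset V)
      rw [card_compl] at h1
      have := (hrig x y hxy h).2.2.1
      omega
    by_cases hall : ∃ x y, x ≠ y ∧ ¬ G.Adj x y ∧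
        #(G.neighborFinset x ∩ G.neighborFinset y) + 2 = Fintype.card V
    · obtain ⟨x, y, hxy, h, hcard⟩ := hall
      refine Or.inl ⟨x, y, hxy, fun a b => ?_⟩
      have hK : G.neighborFinset x ∩ G.neighborFinset y = ({x, y} : Finset V)ᶜ := by
        refine eq_of_subset_of_card_le (fun a ha => ?_) ?_
        · simp only [mem_inter, SimpleGraph.mem_neighborFinset] at ha
          simp [ha.1.ne', ha.2.ne']
        · rw [card_compl, card_pair hxy]; omega
      have hfull : ∀ a, a ≠ x → a ≠ y → ∀ b, a ≠ b → G.Adj a b := fun a hax hay b =>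
        adj_of_degree_add_one_eq_card ((hrig x y hxy h).2.2.2 a (by simp [hK, hax, hay]))
      have hsymm : ∀ a b, G.Adj a b → G.Adj b a := fun _ _ h => h.symm
      rw [SimpleGraph.compl_adj]
      grind
    · push Not at hall
      have hone : ∀ x y, x ≠ y → ¬ G.Adj x y → ∀ z, G.Adj x z → G.Adj y z → z = u := by
        intro x y hxy h z hxz hyz
        have hc := (hrig x y hxy h).1.resolve_right (hall x y hxy h)
        exact card_le_one.1 hc.le z (by simp [hxz, hyz]) u (by simpa using hnu x y hxy h)
      have hiff := compl_adj_iff_of_split hne hvw hu fun x y z hxy h hzx hzy hzu =>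
        ⟨fun h1 h2 => hzu (hone x y hxy h z h1.symm h2.symm),
          fun h1 => ((hcover x y hxy h z hzx hzy).resolve_right fun h2 => h1 h2.symm).symm⟩
      obtain ⟨hk, hd, hU, -⟩ := hrig v w hne hvw
      replace hk := hk.resolve_right (hall v w hne hvw)
      have hui := card_union_add_card_inter (G.neighborFinset v) (G.neighborFinset w)
      rw [SimpleGraph.card_neighborFinset_eq_degree, SimpleGraph.card_neighborFinset_eq_degree]
        at hui
      have hdc : ∀ x, Gᶜ.degree x + G.degree x + 1 = Fintype.card V := fun x => by
        have := G.degree_compl x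
        have := G.degree_lt_card_verts x
        omega
      refine Or.inr ⟨Gᶜ.neighborFinset w, Gᶜ.neighborFinset v, ?_, ?_, ?_, fun x y => ?_⟩
      · rw [Finset.disjoint_left]
        intro x hx hy
        simp only [SimpleGraph.mem_neighborFinset, SimpleGraph.compl_adj] at hx hy
        exact (hcover v w hne hvw x hy.1.symm hx.1.symm).elim hy.2 hx.2
      · rw [SimpleGraph.card_neighborFinset_eq_degree, eq_sub_iff_add_eq]
        have := hdc w
        exact_mod_cast (by omega : 2 * Gᶜ.degree w + 1 = Fintype.card V)
      · rw [SimpleGraph.card_neighborFinset_eq_degree, eq_sub_iff_add_eq]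
        have := hdc v
        exact_mod_cast (by omega : 2 * Gᶜ.degree v + 1 = Fintype.card V)
      · simpa using hiff x y
  · rintro (⟨v, w, hne, hadj⟩ | ⟨P, Q, hPQ, hP, hQ, hadj⟩)
    · refine isMax_of_compl_bipartite hdeg (P := {v}) (Q := {w}) (p := 1) (by simpa using hne)
        (by simp) (by simp) ?_ (Or.inl rfl) (by simpa using hadj)
      obtain ⟨u, hu⟩ := (G.degree_pos_iff_exists_adj v).1 (hdeg v)
      refine Fintype.two_lt_card_iff.2 ⟨v, w, u, hne, hu.ne, ?_⟩
      rintro rfl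
      exact ((hadj v w).2 (Or.inl ⟨rfl, rfl⟩)).2 hu
    · refine isMax_of_compl_bipartite hdeg hPQ rfl (by linarith) ?_ (Or.inr hP) hadj
      have h1 : 2 * #P + 1 = Fintype.card V := by
        rw [eq_sub_iff_add_eq] at hP; exact_mod_cast hP
      by_contra! h2
      obtain ⟨x⟩ : Nonempty V := Fintype.card_pos_iff.1 (by omega)
      have := hdeg x
      have := G.degree_lt_card_verts x
      omega
end
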